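/- arXiv:2403.19119 — 4 statements merged into one kernel-verified Lean document; each statement's English description precedes it below -/
import Mathlib

section
/- Let n, k be finite index types, Σ : Matrix n n ℂ Hermitian, M : Matrix k n ℂ, R : Matrix k k ℂ positive definite, and W : Matrix n n ℂ positive semidefinite. Define E(U) := Σ − U·M − Mᴴ·Uᴴ + U·R·Uᴴ and the LMMSE filter U⋆ := Mᴴ·R⁻¹. Then for every U : Matrix n k ℂ, Re(trace(W·E(U⋆))) ≤ Re(trace(W·E(U))). Moreover, if W is positive definite, then equality holds if and only if U = U⋆. -/
open Matrix ComplexOrder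

namespace Matrix

/-- Completing the square for the mean-squared-error matrix. -/
lemma mse_eq_add_mul_mul_conjTranspose {n k : Type*} [Fintype k] [DecidableEq k]
    (S : Matrix n n ℂ) (M : Matrix k n ℂ)
    {R : Matrix k k ℂ} (hR : R.PosDef) (U : Matrix n k ℂ) :
    S - U * M - Mᴴ * Uᴴ + U * R * Uᴴ =
      S - Mᴴ * R⁻¹ * M + (U - Mᴴ * R⁻¹) * R * (U - Mᴴ * R⁻¹)ᴴ := by
  have hdet := (isUnit_iff_isUnit_det _).mp hR.isUnit
  have hconj : (Mᴴ * R⁻¹)ᴴ = R⁻¹ * M := by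
    rw [conjTranspose_mul, conjTranspose_conjTranspose, hR.isHermitian.inv.eq]
  rw [conjTranspose_sub, hconj, Matrix.sub_mul, nonsing_inv_mul_cancel_right _ _ hdet,
    Matrix.mul_sub, Matrix.sub_mul, Matrix.sub_mul, ← Matrix.mul_assoc (U * R),
    mul_nonsing_inv_cancel_right _ _ hdet, ← Matrix.mul_assoc Mᴴ]
  abel

variable {n k : Type*} [Fintype n] [Fintype k]

open scoped MatrixOrder in
lemma PosSemidef.exists_eq_conjTranspose_mul_self {W : Matrix n n ℂ} (hW : W.PosSemidef) :
    ∃ B : Matrix n n ℂ, W = Bᴴ * B := by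
  classical
  exact CStarAlgebra.nonneg_iff_eq_star_mul_self.mp hW.nonneg

/-- Factoring `W = Bᴴ * B`, the weighted trace of `D * R * Dᴴ` is the trace of
`(B * D) * R * (B * D)ᴴ`. -/
lemma trace_conjTranspose_mul_self_mul (B : Matrix n n ℂ) (D : Matrix n k ℂ)
    (R : Matrix k k ℂ) :
    (Bᴴ * B * (D * R * Dᴴ)).trace = (B * D * R * (B * D)ᴴ).trace := by
  rw [conjTranspose_mul, Matrix.mul_assoc Bᴴ, trace_mul_comm]
  simp only [Matrix.mul_assoc]

lemma PosSemidef.re_trace_mul_nonneg {W : Matrix n n ℂ} (hW : W.PosSemidef)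
    {R : Matrix k k ℂ} (hR : R.PosSemidef) (D : Matrix n k ℂ) :
    0 ≤ (W * (D * R * Dᴴ)).trace.re := by
  obtain ⟨B, rfl⟩ := hW.exists_eq_conjTranspose_mul_self
  rw [trace_conjTranspose_mul_self_mul]
  exact (Complex.le_def.mp (hR.mul_mul_conjTranspose_same (B * D)).trace_nonneg).1

lemma PosDef.re_trace_mul_eq_zero_iff {W : Matrix n n ℂ} (hW : W.PosDef)
    {R : Matrix k k ℂ} (hR : R.PosDef) (D : Matrix n k ℂ) :
    (W * (D * R * Dᴴ)).trace.re = 0 ↔ D = 0 := by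
  classical
  refine ⟨fun h => ?_, fun h => by simp [h]⟩
  obtain ⟨B, rfl⟩ := hW.posSemidef.exists_eq_conjTranspose_mul_self
  obtain ⟨C, rfl⟩ := hR.posSemidef.exists_eq_conjTranspose_mul_self
  rw [trace_conjTranspose_mul_self_mul] at h
  have hP := hR.posSemidef.mul_mul_conjTranspose_same (B * D)
  have htrace : (B * D * (Cᴴ * C) * (B * D)ᴴ).trace = 0 :=
    Complex.ext h (Complex.le_def.mp hP.trace_nonneg).2.symm
  have hfactor : B * D * (Cᴴ * C) * (B * D)ᴴ = (B * D * Cᴴ) * (B * D * Cᴴ)ᴴ := by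
    simp only [conjTranspose_mul, conjTranspose_conjTranspose, Matrix.mul_assoc]
  rw [hfactor, trace_mul_conjTranspose_self_eq_zero_iff] at htrace
  have hzero : Bᴴ * B * D * (Cᴴ * C) = 0 := by
    calc Bᴴ * B * D * (Cᴴ * C) = Bᴴ * (B * D * Cᴴ) * C := by simp only [Matrix.mul_assoc]
      _ = 0 := by simp [htrace]
  have hWdet := (isUnit_iff_isUnit_det _).mp hW.isUnit
  have hRdet := (isUnit_iff_isUnit_det _).mp hR.isUnit
  calc D = (Bᴴ * B)⁻¹ * (Bᴴ * B * D * (Cᴴ * C)) * (Cᴴ * C)⁻¹ := by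
        rw [← Matrix.mul_assoc, mul_nonsing_inv_cancel_right _ _ hRdet,
          nonsing_inv_mul_cancel_left _ _ hWdet]
    _ = 0 := by simp [hzero]

end Matrix



/-- Optimality of the LMMSE linear receive filter `U⋆ = Mᴴ·R⁻¹` for the
weighted MSE objective `U ↦ Re(trace(W·E(U)))`, where
`E(U) = Σ − U·M − Mᴴ·Uᴴ + U·R·Uᴴ`; with uniqueness of the minimizer when the
weight matrix `W` is positive definite. -/
theorem lmmse_filter_optimal
    {n k : Type*} [Fintype n] [Fintype k] [DecidableEq k]
    (Cov : Matrix n n ℂ) (M : Matrix k n ℂ) (R : Matrix k k ℂ)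
    (W : Matrix n n ℂ)
    (hCov : Cov.IsHermitian) (hR : R.PosDef) (hW : W.PosSemidef)
    (E : Matrix n k ℂ → Matrix n n ℂ)
    (hE : ∀ U, E U = Cov - U * M - Mᴴ * Uᴴ + U * R * Uᴴ)
    (Ustar : Matrix n k ℂ) (hUstar : Ustar = Mᴴ * R⁻¹) :
    (∀ U : Matrix n k ℂ,
        (Matrix.trace (W * E Ustar)).re ≤ (Matrix.trace (W * E U)).re) ∧
    (W.PosDef → ∀ U : Matrix n k ℂ,
        ((Matrix.trace (W * E Ustar)).re = (Matrix.trace (W * E U)).re ↔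
          U = Ustar)) := by
  have hmse (U : Matrix n k ℂ) : (W * E U).trace.re =
      (W * E Ustar).trace.re + (W * ((U - Ustar) * R * (U - Ustar)ᴴ)).trace.re := by
    rw [hE, hE, mse_eq_add_mul_mul_conjTranspose Cov M hR U,
      mse_eq_add_mul_mul_conjTranspose Cov M hR Ustar, ← hUstar]
    simp [Matrix.mul_add]
  refine ⟨fun U => ?_, fun hW' U => ?_⟩
  · rw [hmse U]
    exact le_add_of_nonneg_right (hW.re_trace_mul_nonneg hR.posSemidef _)
  · rw [hmse U, left_eq_add, hW'.re_trace_mul_eq_zero_iff hR, sub_eq_zero]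
end

section
/- Let n, k be finite index types, Σ : Matrix n n ℂ positive definite, R : Matrix k k ℂ positive definite, and S : Matrix k n ℂ. Then the MMSE matrix E⋆ := Σ − Σ·Sᴴ·(S·Σ·Sᴴ + R)⁻¹·S·Σ is positive definite (in particular invertible). -/
open Matrix ComplexOrder

/-- The MMSE matrix `E⋆ = Σ − Σ·Sᴴ·(S·Σ·Sᴴ + R)⁻¹·S·Σ` of the optimal linear
receive filter is positive definite (in particular invertible) whenever
`Σ` and `R` are positive definite. -/
theorem mmse_matrix_posDef
    {n k : Type*} [Fintype n] [Fintype k] [DecidableEq n] [DecidableEq k]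
    (Cov : Matrix n n ℂ) (R : Matrix k k ℂ) (S : Matrix k n ℂ)
    (hCov : Cov.PosDef) (hR : R.PosDef) :
    (Cov - Cov * Sᴴ * (S * Cov * Sᴴ + R)⁻¹ * S * Cov).PosDef := by
  have hA : (Cov⁻¹ + Sᴴ * R⁻¹ * S).PosDef :=
    hCov.inv.add_posSemidef (hR.inv.posSemidef.conjTranspose_mul_mul_same S)
  have hD : (S * Cov * Sᴴ + R).PosDef :=
    PosDef.posSemidef_add (hCov.posSemidef.mul_mul_conjTranspose_same S) hR
  have hCovInv : Cov⁻¹⁻¹ = Cov := nonsing_inv_nonsing_inv _ ((isUnit_iff_isUnit_det _).1 hCov.isUnit)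
  have hRInv : R⁻¹⁻¹ = R := nonsing_inv_nonsing_inv _ ((isUnit_iff_isUnit_det _).1 hR.isUnit)
  have woodbury := add_mul_mul_inv_eq_sub Cov⁻¹ Sᴴ R⁻¹ S hCov.inv.isUnit hR.inv.isUnit
    (by rw [hCovInv, hRInv, add_comm]; exact hD.isUnit)
  rw [hCovInv, hRInv, add_comm R] at woodbury
  exact woodbury ▸ hA.inv
end

section
/- Let n, k be finite index types, Σ : Matrix n n ℂ positive definite, R : Matrix k k ℂ positive definite, and S : Matrix k n ℂ. Let E⋆ := Σ − Σ·Sᴴ·(S·Σ·Sᴴ + R)⁻¹·S·Σ. Then det Σ = det E⋆ · det(1 + S·Σ·Sᴴ·R⁻¹), where 1 denotes the k×k identity matrix. -/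
open Matrix ComplexOrder

/-- The determinant of a Schur-type downdate, over any commutative ring. -/
theorem Matrix.det_sub_mul_inv_mul_mul_det_one_add {n k α : Type*} [Fintype n] [Fintype k]
    [DecidableEq n] [DecidableEq k] [CommRing α]
    (A : Matrix n n α) (U : Matrix n k α) (V : Matrix k n α) (R : Matrix k k α)
    (hR : IsUnit R.det) (hM : IsUnit (V * A * U + R).det) :
    (A - A * U * (V * A * U + R)⁻¹ * V * A).det * (1 + V * A * U * R⁻¹).det = A.det := by
  set M := V * A * U + R with hMdef
  have hfactor : A - A * U * M⁻¹ * V * A = A * (1 - U * M⁻¹ * (V * A)) := by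
    simp only [Matrix.mul_sub, Matrix.mul_one, Matrix.mul_assoc]
  have hdown : 1 - V * A * (U * M⁻¹) = R * M⁻¹ := by
    rw [← Matrix.mul_assoc, ← Matrix.mul_nonsing_inv M hM, ← Matrix.sub_mul, hMdef,
      add_sub_cancel_left]
  have hup : 1 + V * A * U * R⁻¹ = M * R⁻¹ := by
    rw [hMdef, Matrix.add_mul, Matrix.mul_nonsing_inv R hR, add_comm]
  have hcancel : R * M⁻¹ * (M * R⁻¹) = 1 := by
    rw [Matrix.mul_assoc, Matrix.nonsing_inv_mul_cancel_left _ _ hM,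
      Matrix.mul_nonsing_inv R hR]
  rw [hfactor, det_mul, det_one_sub_mul_comm, hdown, hup, mul_assoc, ← det_mul (R * M⁻¹),
    hcancel, det_one, mul_one]

/-- Determinant identity linking the MMSE matrix to the rate expression:
`det Σ = det E⋆ · det(I + S·Σ·Sᴴ·R⁻¹)` where
`E⋆ = Σ − Σ·Sᴴ·(S·Σ·Sᴴ + R)⁻¹·S·Σ`. -/
theorem mmse_det_rate_identity
    {n k : Type*} [Fintype n] [Fintype k] [DecidableEq n] [DecidableEq k]
    (Cov : Matrix n n ℂ) (R : Matrix k k ℂ) (S : Matrix k n ℂ)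
    (hCov : Cov.PosDef) (hR : R.PosDef) :
    Cov.det =
      (Cov - Cov * Sᴴ * (S * Cov * Sᴴ + R)⁻¹ * S * Cov).det *
        ((1 : Matrix k k ℂ) + S * Cov * Sᴴ * R⁻¹).det := by
  have hM : (S * Cov * Sᴴ + R).PosDef :=
    PosDef.posSemidef_add (hCov.posSemidef.mul_mul_conjTranspose_same S) hR
  exact (det_sub_mul_inv_mul_mul_det_one_add Cov Sᴴ S R
    hR.det_pos.ne'.isUnit hM.det_pos.ne'.isUnit).symm
end

section
/- Let n be a finite index type with N := card n, and let E, W : Matrix n n ℂ both be positive definite. Then Re(trace(W·E)) − Real.log((det W).re) ≥ N + Real.log((det E).re), with equality if and only if W = E⁻¹. (For Hermitian positive definite matrices the determinant is a positive real number, so taking the real part is harmless.) -/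
open Matrix ComplexOrder

namespace Matrix

variable {n : Type*} [Fintype n] [DecidableEq n]

lemma PosDef.log_re_det {A : Matrix n n ℂ} (hA : A.PosDef) :
    Real.log A.det.re = ∑ i, Real.log (hA.1.eigenvalues i) := by
  have h : A.det.re = ∏ i, hA.1.eigenvalues i := by
    rw [hA.1.det_eq_prod_eigenvalues]
    exact_mod_cast rfl
  rw [h, Real.log_prod fun i _ => (hA.eigenvalues_pos i).ne']

lemma IsHermitian.re_trace {A : Matrix n n ℂ} (hA : A.IsHermitian) :
    A.trace.re = ∑ i, hA.eigenvalues i := by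
  rw [hA.trace_eq_sum_eigenvalues]
  exact_mod_cast rfl

lemma IsHermitian.eq_one_of_eigenvalues {A : Matrix n n ℂ} (hA : A.IsHermitian)
    (h : ∀ i, hA.eigenvalues i = 1) : A = 1 := by
  rw [hA.spectral_theorem]
  have : diagonal (RCLike.ofReal ∘ hA.eigenvalues) = (1 : Matrix n n ℂ) := by
    rw [← diagonal_one]
    congr 1
    ext i
    simp [h i]
  rw [this, map_one]

/-- The bound `N + log det A ≤ tr A` for a positive definite matrix `A` of size `N`. -/
lemma PosDef.card_add_log_det_le_trace {A : Matrix n n ℂ} (hA : A.PosDef) :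
    (Fintype.card n : ℝ) + Real.log A.det.re ≤ A.trace.re := by
  rw [hA.log_re_det, hA.1.re_trace, ← Finset.card_univ, Finset.cast_card,
    ← Finset.sum_add_distrib]
  exact Finset.sum_le_sum fun i _ => by
    linarith [Real.log_le_sub_one_of_pos (hA.eigenvalues_pos i)]

lemma PosDef.trace_eq_card_add_log_det_iff {A : Matrix n n ℂ} (hA : A.PosDef) :
    A.trace.re = (Fintype.card n : ℝ) + Real.log A.det.re ↔ A = 1 := by
  refine ⟨fun h => hA.1.eq_one_of_eigenvalues fun i => ?_, fun h => by simp [h]⟩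
  by_contra hi
  refine h.not_gt ?_
  rw [hA.log_re_det, hA.1.re_trace, ← Finset.card_univ, Finset.cast_card,
    ← Finset.sum_add_distrib]
  refine Finset.sum_lt_sum (fun j _ => ?_) ⟨i, Finset.mem_univ i, ?_⟩
  · linarith [Real.log_le_sub_one_of_pos (hA.eigenvalues_pos j)]
  · linarith [Real.log_lt_sub_one_of_pos (hA.eigenvalues_pos i) hi]

open scoped MatrixOrder Matrix.Norms.L2Operator in
lemma PosDef.exists_isUnit_eq_conjTranspose_mul_self {E : Matrix n n ℂ} (hE : E.PosDef) :
    ∃ B : Matrix n n ℂ, IsUnit B ∧ E = Bᴴ * B :=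
  CStarAlgebra.isStrictlyPositive_iff_eq_star_mul_self.mp hE.isStrictlyPositive

lemma PosDef.log_re_det_mul {E W : Matrix n n ℂ} (hE : E.PosDef) (hW : W.PosDef) :
    Real.log (W.det * E.det).re = Real.log W.det.re + Real.log E.det.re := by
  obtain ⟨hEre, hEim⟩ := Complex.pos_iff.mp hE.det_pos
  obtain ⟨hWre, -⟩ := Complex.pos_iff.mp hW.det_pos
  rw [Complex.mul_re, ← hEim, mul_zero, sub_zero, Real.log_mul hWre.ne' hEre.ne']

end Matrix

/-- Optimality of the WMMSE weight matrix: for positive definite `E` and `W`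
of size `N`, `Re(trace(W·E)) − log((det W).re) ≥ N + log((det E).re)`, with
equality if and only if `W = E⁻¹`. -/
theorem wmmse_weight_optimal
    {n : Type*} [Fintype n] [DecidableEq n]
    (E W : Matrix n n ℂ) (hE : E.PosDef) (hW : W.PosDef) :
    ((Fintype.card n : ℝ) + Real.log (E.det.re) ≤
        (Matrix.trace (W * E)).re - Real.log (W.det.re)) ∧
    ((Matrix.trace (W * E)).re - Real.log (W.det.re) =
        (Fintype.card n : ℝ) + Real.log (E.det.re) ↔ W = E⁻¹) := by
  obtain ⟨B, hB, hEB⟩ := hE.exists_isUnit_eq_conjTranspose_mul_self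
  have hA : (B * W * Bᴴ).PosDef := (hB.posDef_star_right_conjugate_iff).mpr hW
  have htrace : (B * W * Bᴴ).trace = (W * E).trace := by
    rw [hEB, Matrix.mul_assoc, Matrix.trace_mul_comm, Matrix.mul_assoc]
  have hdet : Real.log (B * W * Bᴴ).det.re = Real.log W.det.re + Real.log E.det.re := by
    rw [← hE.log_re_det_mul hW, hEB]
    simp only [Matrix.det_mul]
    ring_nf
  have hone : B * W * Bᴴ = 1 ↔ W = E⁻¹ := by
    rw [Matrix.mul_assoc, mul_eq_one_comm, Matrix.mul_assoc, ← hEB]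
    exact ⟨fun h => (Matrix.inv_eq_left_inv h).symm,
      fun h => h ▸ Matrix.nonsing_inv_mul E hE.det_pos.ne'.isUnit⟩
  have hle := hA.card_add_log_det_le_trace
  have heq := hA.trace_eq_card_add_log_det_iff
  rw [htrace, hdet] at hle heq
  refine ⟨by linarith, ?_⟩
  rw [← hone, ← heq]
  constructor <;> intro h <;> linarith
end
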